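/- Let p be a prime, q a power of p, and n = p^α · n_0 ≥ 5 with p not dividing n_0 and 1 < gcd(q − 1, n_0) = s < n_0. If q^{n/2 − 2} ≥ 2^{n/2 − 2} · min(q², n²/4) · W(q^n − 1), then N_f(x^n − 1, q^n − 1) > 0 for every monic factor f of degree 2 of x^n − 1 in F_q[x]. -/

import Mathlib

open Polynomial

noncomputable section

/-- The linearized `q`-associate of `f = Σ a_i x^i ∈ F_q[x]`, evaluated at `α ∈ F_{q^n}`:
`L_f(α) = Σ a_i α^{q^i}`. -/
def Lf {F E : Type*} [Field F] [Field E] [Algebra F E] (q : ℕ) (f : Polynomial F) (α : E) : E :=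
  ∑ i ∈ Finset.range (f.natDegree + 1), algebraMap F E (f.coeff i) * α ^ q ^ i

/-- For `m ∣ q^n - 1`, an element `α ∈ F_{q^n}*` is `m`-free if whenever `α = β^d` for some
`β ∈ F_{q^n}` and some divisor `d` of `m`, then `d = 1`. -/
def IsFree {E : Type*} [Field E] (m : ℕ) (α : E) : Prop :=
  α ≠ 0 ∧ ∀ d : ℕ, d ∣ m → (∃ β : E, α = β ^ d) → d = 1

/-- For a monic divisor `T` of `x^n - 1` in `F_q[x]`, an element `α ∈ F_{q^n}` is `T`-free
if whenever `α = L_h(β)` for some `β ∈ F_{q^n}` and some monic divisor `h` of `T`,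
then `h = 1`. -/
def IsPolyFree {F E : Type*} [Field F] [Field E] [Algebra F E] (q : ℕ) (T : Polynomial F)
    (α : E) : Prop :=
  ∀ h : Polynomial F, h.Monic → h ∣ T → (∃ β : E, Lf q h β = α) → h = 1

/-- `Nf q F E f T m` is the number of `T`-free elements `α ∈ F_{q^n}` such that `L_f(α)` is
`m`-free. -/
def Nf (q : ℕ) (F E : Type*) [Field F] [Field E] [Algebra F E]
    (f T : Polynomial F) (m : ℕ) : ℕ :=
  Nat.card {α : E // IsPolyFree q T α ∧ IsFree m (Lf q f α)}

/-- `Wnat m` is the number of squarefree divisors of the integer `m`. -/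
def Wnat (m : ℕ) : ℕ := Nat.card {d : ℕ // d ∣ m ∧ Squarefree d}

/-- `Wpoly T` is the number of squarefree monic divisors of the polynomial `T`. -/
def Wpoly {F : Type*} [Field F] (T : Polynomial F) : ℕ :=
  Nat.card {h : Polynomial F // h.Monic ∧ Squarefree h ∧ h ∣ T}

/-- `radNat m` is the largest squarefree divisor of the positive integer `m`. -/
def radNat (m : ℕ) : ℕ := ∏ p ∈ m.primeFactors, p

/-- `radPoly T` is the monic squarefree radical of the polynomial `T` : the product of its
distinct monic irreducible factors. -/
def radPoly {F : Type*} [Field F] (T : Polynomial F) : Polynomial F :=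
  letI := Classical.decEq F
  ∏ p ∈ (UniqueFactorizationMonoid.normalizedFactors T).toFinset, p

/-- Multiplication by `w` increases the largest modulus of a Fourier coefficient by at most the
factor `C`. -/
def FourierMultBound {A : Type*} [AddCommGroup A] [Fintype A] (w : A → ℂ) (C : ℝ) : Prop :=
  ∀ (g : A → ℂ) (B : ℝ), (∀ ψ : AddChar A ℂ, ‖∑ a, g a * ψ a‖ ≤ B) →
    ∀ ψ : AddChar A ℂ, ‖∑ a, g a * w a * ψ a‖ ≤ C * B

namespace FourierMultBound

variable {A : Type*} [AddCommGroup A] [Fintype A] {v w : A → ℂ} {C D : ℝ}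

lemma mono (hw : FourierMultBound w C) (h : C ≤ D) : FourierMultBound w D := fun g B hB ψ =>
  (hw g B hB ψ).trans (mul_le_mul_of_nonneg_right h ((norm_nonneg _).trans (hB ψ)))

lemma mul (hv : FourierMultBound v C) (hw : FourierMultBound w D) :
    FourierMultBound (fun a => v a * w a) (C * D) := by
  intro g B hB ψ
  have h := hv (fun a => g a * w a) (D * B) (hw g B hB) ψ
  calc _ = ‖∑ a, g a * w a * v a * ψ a‖ := by
        congr 1; exact Finset.sum_congr rfl fun a _ => by ring
    _ ≤ _ := h.trans_eq (mul_assoc _ _ _).symm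

lemma add (hv : FourierMultBound v C) (hw : FourierMultBound w D) :
    FourierMultBound (fun a => v a + w a) (C + D) := by
  intro g B hB ψ
  calc _ = ‖∑ a, g a * v a * ψ a + ∑ a, g a * w a * ψ a‖ := by
        rw [← Finset.sum_add_distrib]
        congr 1; exact Finset.sum_congr rfl fun a _ => by ring
    _ ≤ _ := (norm_add_le _ _).trans ((add_le_add (hv g B hB ψ) (hw g B hB ψ)).trans_eq
        (add_mul _ _ _).symm)

lemma const_mul (hw : FourierMultBound w C) (c : ℂ) :
    FourierMultBound (fun a => c * w a) (‖c‖ * C) := by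
  intro g B hB ψ
  calc _ = ‖c * ∑ a, g a * w a * ψ a‖ := by
        rw [Finset.mul_sum]
        congr 1; exact Finset.sum_congr rfl fun a _ => by ring
    _ ≤ _ := by
        rw [norm_mul, mul_assoc]
        exact mul_le_mul_of_nonneg_left (hw g B hB ψ) (norm_nonneg _)

lemma addChar (χ : AddChar A ℂ) : FourierMultBound (fun a => χ a) 1 := by
  intro g B hB ψ
  simpa [mul_assoc] using hB (χ * ψ)

lemma const (c : ℂ) : FourierMultBound (fun _ : A => c) ‖c‖ := by
  simpa using (addChar (1 : AddChar A ℂ)).const_mul c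

lemma sum {ι : Type*} (s : Finset ι) {f : ι → A → ℂ} {c : ι → ℝ}
    (h : ∀ i ∈ s, FourierMultBound (f i) (c i)) :
    FourierMultBound (fun a => ∑ i ∈ s, f i a) (∑ i ∈ s, c i) := by
  classical
  induction s using Finset.induction_on with
  | empty => simpa using const (A := A) 0
  | insert i s hi ih =>
    simp only [Finset.sum_insert hi]
    exact (h i (by simp)).add (ih fun j hj => h j (by simp [hj]))

lemma prod {ι : Type*} (s : Finset ι) {f : ι → A → ℂ} {c : ι → ℝ}
    (h : ∀ i ∈ s, FourierMultBound (f i) (c i)) :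
    FourierMultBound (fun a => ∏ i ∈ s, f i a) (∏ i ∈ s, c i) := by
  classical
  induction s using Finset.induction_on with
  | empty => simpa using const (A := A) 1
  | insert i s hi ih =>
    simp only [Finset.prod_insert hi]
    exact (h i (by simp)).mul (ih fun j hj => h j (by simp [hj]))

open Classical in
lemma indicator_sub (H : AddSubgroup A) :
    FourierMultBound (fun a => (if a ∈ H then 1 else 0) - (H.index : ℂ)⁻¹)
      (1 - (H.index : ℝ)⁻¹) := by
  have : Fintype (A ⧸ H) := Fintype.ofFinite _
  have hcard : Fintype.card (A ⧸ H) = H.index := by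
    rw [AddSubgroup.index, Nat.card_eq_fintype_card]
  have h0 : (H.index : ℂ) ≠ 0 := by
    rw [← hcard]; exact_mod_cast Fintype.card_ne_zero
  have h0' : (H.index : ℝ) ≠ 0 := by exact_mod_cast h0
  have key : (fun a => (if a ∈ H then (1 : ℂ) else 0) - (H.index : ℂ)⁻¹) =
      fun a => (H.index : ℂ)⁻¹ * ∑ ψ ∈ Finset.univ.erase (0 : AddChar (A ⧸ H) ℂ),
        (ψ.compAddMonoidHom (QuotientAddGroup.mk' H)) a := by
    funext a
    have h := AddChar.sum_apply_eq_ite (a : A ⧸ H)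
    rw [← Finset.add_sum_erase _ _ (Finset.mem_univ 0), hcard] at h
    simp only [AddChar.zero_apply, QuotientAddGroup.eq_zero_iff] at h
    have h' : ∑ ψ ∈ Finset.univ.erase (0 : AddChar (A ⧸ H) ℂ),
        (ψ.compAddMonoidHom (QuotientAddGroup.mk' H)) a =
          (if a ∈ H then (H.index : ℂ) else 0) - 1 := by
      rw [← h]; simp
    rw [h']
    split_ifs
    · field_simp
    · ring
  rw [key]
  refine ((sum _ (c := fun _ => 1) fun ψ _ => addChar _).const_mul _).mono (le_of_eq ?_)
  rw [Finset.sum_const, Finset.card_erase_of_mem (Finset.mem_univ _), Finset.card_univ,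
    AddChar.card_eq, hcard, nsmul_eq_mul, Nat.cast_sub (by
      rw [← hcard]; exact Fintype.card_pos)]
  simp
  field_simp

open Classical in
lemma one_sub_indicator (H : AddSubgroup A) :
    FourierMultBound (fun a => 1 - if a ∈ H then 1 else 0) (2 * (1 - (H.index : ℝ)⁻¹)) := by
  have h0 : (H.index : ℝ)⁻¹ ≤ 1 := by
    rw [← Nat.cast_one (R := ℝ)]
    exact_mod_cast Nat.cast_inv_le_one H.index
  have h := (const (A := A) (1 - (H.index : ℂ)⁻¹)).add ((indicator_sub H).const_mul (-1))
  have e : ‖(1 - (H.index : ℂ)⁻¹)‖ = 1 - (H.index : ℝ)⁻¹ := by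
    rw [← Complex.norm_of_nonneg (sub_nonneg.2 h0)]
    push_cast; rfl
  rw [e, norm_neg, norm_one, one_mul, ← two_mul] at h
  convert h using 2
  ring

open Classical in
lemma one_sub_sum_indicator {ι : Type*} (s : Finset ι) (H : ι → AddSubgroup A) {k : ℕ}
    (hk : ∀ i ∈ s, (H i).index = k) (hs : s.card ≤ k) :
    FourierMultBound (fun a => 1 - ∑ i ∈ s, if a ∈ H i then 1 else 0)
      (1 - s.card / k + s.card * (1 - (k : ℝ)⁻¹)) := by
  have h := (const (A := A) (1 - s.card / k : ℂ)).add
    ((sum s (fun i hi => indicator_sub (H i))).const_mul (-1))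
  have h0 : (s.card / k : ℝ) ≤ 1 := div_le_one_of_le₀ (by exact_mod_cast hs) (by positivity)
  have e : ‖(1 - s.card / k : ℂ)‖ = 1 - (s.card / k : ℝ) := by
    rw [← Complex.norm_of_nonneg (sub_nonneg.2 h0)]
    push_cast; rfl
  rw [e, norm_neg, norm_one, one_mul, Finset.sum_congr rfl (fun i hi => by rw [hk i hi]),
    Finset.sum_const, nsmul_eq_mul] at h
  convert h using 2 with a
  have hsum : ∑ i ∈ s, ((H i).index : ℂ)⁻¹ = s.card * (k : ℂ)⁻¹ := by
    rw [Finset.sum_congr rfl fun i hi => by rw [hk i hi], Finset.sum_const, nsmul_eq_mul]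
  rw [Finset.sum_sub_distrib, hsum]
  ring

end FourierMultBound

lemma norm_gaussSum_eq {E : Type*} [Field E] [Fintype E] {χ : MulChar E ℂ} (hχ : χ ≠ 1)
    {ψ : AddChar E ℂ} (hψ : ψ ≠ 1) : ‖gaussSum χ ψ‖ = √(Fintype.card E) := by
  have h := gaussSum_mul_gaussSum_eq_card hχ (AddChar.IsPrimitive.of_ne_one hψ)
  rw [← star_gaussSum_eq] at h
  have h2 : ‖gaussSum χ ψ‖ ^ 2 = Fintype.card E := by
    have := congrArg norm h
    rw [norm_mul, norm_star, Complex.norm_natCast] at this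
    rw [sq, this]
  rw [← h2, Real.sqrt_sq (norm_nonneg _)]

lemma norm_gaussSum_le {E : Type*} [Field E] [Fintype E] {χ : MulChar E ℂ} (hχ : χ ≠ 1)
    (ψ : AddChar E ℂ) : ‖gaussSum χ ψ‖ ≤ √(Fintype.card E) := by
  by_cases hψ : ψ = 1
  · subst hψ
    rw [gaussSum_one_right hχ, norm_zero]
    positivity
  · exact (norm_gaussSum_eq hχ hψ).le

open Classical in
/-- The sum of an additive character over a fibre of an endomorphism `L`, expanded in
characters. -/
lemma sum_addChar_fiber {A : Type*} [AddCommGroup A] [Fintype A] (L : A →+ A) (ψ : AddChar A ℂ)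
    (b : A) : (∑ a, if L a = b then ψ a else 0) =
      ∑ η : AddChar A ℂ with η.compAddMonoidHom L * ψ = 1, η (-b) := by
  have h0 : (Fintype.card A : ℂ) ≠ 0 := by exact_mod_cast Fintype.card_ne_zero
  apply mul_left_cancel₀ h0
  have h1 : ∀ a, (Fintype.card A : ℂ) * (if L a = b then ψ a else 0) =
      ∑ η : AddChar A ℂ, η (-b) * (η.compAddMonoidHom L * ψ) a := by
    intro a
    have h := AddChar.sum_apply_eq_ite (L a + -b)
    have : ∑ η : AddChar A ℂ, η (-b) * (η.compAddMonoidHom L * ψ) a =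
        (∑ η : AddChar A ℂ, η (L a + -b)) * ψ a := by
      rw [Finset.sum_mul]
      refine Finset.sum_congr rfl fun η _ => ?_
      rw [AddChar.map_add_eq_mul, AddChar.mul_apply, AddChar.compAddMonoidHom_apply]
      ring
    rw [this, h]
    simp only [← sub_eq_add_neg, sub_eq_zero]
    split_ifs <;> simp
  rw [Finset.mul_sum, Finset.sum_congr rfl fun a _ => h1 a, Finset.sum_comm, Finset.mul_sum,
    Finset.sum_filter]
  refine Finset.sum_congr rfl fun η _ => ?_
  rw [← Finset.mul_sum, AddChar.sum_eq_ite]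
  split_ifs with h2 h3 h3
  · ring
  · exact absurd h2 h3
  · exact absurd h3 h2
  · simp

/-- A mixed character sum twisted by an endomorphism of the additive group. -/
lemma norm_sum_mulChar_comp_mul_addChar_le {E : Type*} [Field E] [Fintype E] {χ : MulChar E ℂ}
    (hχ : χ ≠ 1) (L : E →+ E) (ψ : AddChar E ℂ) :
    ‖∑ a, χ (L a) * ψ a‖ ≤ Nat.card L.ker * √(Fintype.card E) := by
  classical
  have h1 : ∑ a, χ (L a) * ψ a = ∑ b, χ b * ∑ a, if L a = b then ψ a else 0 := by
    simp_rw [Finset.mul_sum]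
    rw [Finset.sum_comm]
    refine Finset.sum_congr rfl fun a _ => ?_
    simp
  have h2 : ((Finset.univ.filter fun η : AddChar E ℂ => η.compAddMonoidHom L * ψ = 1).card : ℝ) ≤
      Nat.card L.ker := by
    have h := sum_addChar_fiber L ψ 0
    simp only [neg_zero, AddChar.map_zero_eq_one, Finset.sum_const, nsmul_eq_mul, mul_one] at h
    rw [← Complex.norm_natCast, ← h, ← Finset.sum_filter]
    refine (norm_sum_le _ _).trans ?_
    simp only [AddChar.norm_apply, Finset.sum_const, nsmul_eq_mul, mul_one]
    rw [Nat.card_eq_fintype_card, Fintype.card_subtype]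
    simp [AddMonoidHom.mem_ker]
  have h3 : ∑ a, χ (L a) * ψ a =
      ∑ η : AddChar E ℂ with η.compAddMonoidHom L * ψ = 1, gaussSum χ η⁻¹ := by
    rw [h1]
    simp_rw [sum_addChar_fiber, Finset.mul_sum]
    rw [Finset.sum_comm]
    rfl
  rw [h3]
  refine (norm_sum_le_of_le _ fun η _ => norm_gaussSum_le hχ η⁻¹).trans ?_
  rw [Finset.sum_const, nsmul_eq_mul]
  gcongr

open Classical in
/-- If the subgroups `H i` are independent, then so are the corresponding events. -/
lemma sum_prod_indicator {A ι : Type*} [AddCommGroup A] [Fintype A] (s : Finset ι)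
    (H : ι → AddSubgroup A)
    (hH : ∀ t ⊆ s, (⨅ i ∈ t, H i).index = ∏ i ∈ t, (H i).index) (u v : ι → ℂ) :
    ∑ a, ∏ i ∈ s, (u i + v i * if a ∈ H i then 1 else 0) =
      Fintype.card A * ∏ i ∈ s, (u i + v i * ((H i).index : ℂ)⁻¹) := by
  simp_rw [add_comm (u _), Finset.prod_add]
  rw [Finset.sum_comm, Finset.mul_sum]
  refine Finset.sum_congr rfl fun t ht => ?_
  rw [Finset.mem_powerset] at ht
  rw [← Finset.sum_mul, ← mul_assoc]
  congr 1
  simp_rw [Finset.prod_mul_distrib]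
  rw [← Finset.mul_sum, mul_left_comm]
  congr 1
  have hmem : ∀ a, (∏ i ∈ t, if a ∈ H i then (1 : ℂ) else 0) =
      if a ∈ ⨅ i ∈ t, H i then 1 else 0 := by
    intro a
    simp only [Finset.prod_ite_zero, Finset.prod_const_one, AddSubgroup.mem_iInf]
  simp_rw [hmem]
  rw [Finset.sum_boole, Finset.prod_inv_distrib, ← Nat.cast_prod, ← hH t ht,
    ← Fintype.card_subtype]
  have h := (⨅ i ∈ t, H i).card_mul_index
  have h0 : ((⨅ i ∈ t, H i).index : ℂ) ≠ 0 := by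
    exact_mod_cast AddSubgroup.index_ne_zero_of_finite
  rw [eq_mul_inv_iff_mul_eq₀ h0, ← Nat.card_eq_fintype_card, ← Nat.card_eq_fintype_card, ← h]
  push_cast
  rfl

lemma index_iInf_of_pairwise_coprime {A ι : Type*} [AddCommGroup A] [Finite A] (t : Finset ι)
    (H : ι → AddSubgroup A)
    (h : (t : Set ι).Pairwise fun i j => (H i).index.Coprime (H j).index) :
    (⨅ i ∈ t, H i).index = ∏ i ∈ t, (H i).index := by
  classical
  induction t using Finset.induction_on with
  | empty => simp
  | insert i t hi ih =>
    have ih := ih (h.mono (by simp))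
    rw [Finset.iInf_insert, Finset.prod_insert hi]
    refine le_antisymm (AddSubgroup.index_inf_le.trans_eq (by rw [ih])) ?_
    refine Nat.le_of_dvd (Nat.pos_of_ne_zero AddSubgroup.index_ne_zero_of_finite) ?_
    refine Nat.Coprime.mul_dvd_of_dvd_of_dvd ?_ (AddSubgroup.index_dvd_of_le inf_le_left)
      (ih ▸ AddSubgroup.index_dvd_of_le inf_le_right)
    refine Nat.Coprime.prod_right fun j hj => h (by simp) (by simp [hj]) ?_
    rintro rfl
    exact hi hj

section Multiplicative

open scoped Classical

variable (E : Type*) [Field E]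

/-- The subgroup of `d`-th powers, in additive notation. -/
def powSubgroup (d : ℕ) : AddSubgroup (Additive Eˣ) :=
  (nsmulAddMonoidHom d : Additive Eˣ →+ Additive Eˣ).range

variable {E}

lemma mem_powSubgroup {d : ℕ} {x : Additive Eˣ} :
    x ∈ powSubgroup E d ↔ ∃ y : Eˣ, y ^ d = x.toMul := Iff.rfl

variable [Fintype E]

lemma index_powSubgroup {d : ℕ} (hd : d ∣ Fintype.card E - 1) :
    (powSubgroup E d).index = d := by
  have h : Nat.card (Additive Eˣ) = Fintype.card E - 1 := by
    rw [← Nat.card_eq_fintype_card, ← Nat.card_units]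
    exact Nat.card_congr Additive.toMul
  rw [powSubgroup, IsAddCyclic.index_nsmulAddMonoidHom_range, h, Nat.gcd_eq_right hd]

variable (E) in
/-- The indicator function of the primitive elements. -/
def primitiveIndicator (x : Additive Eˣ) : ℂ :=
  ∏ l ∈ (Fintype.card E - 1).primeFactors, (1 - if x ∈ powSubgroup E l then 1 else 0)

lemma primitiveIndicator_eq (x : Additive Eˣ) : primitiveIndicator E x =
    if ∀ l ∈ (Fintype.card E - 1).primeFactors, x ∉ powSubgroup E l then 1 else 0 := by
  have h : ∀ l, (1 - if x ∈ powSubgroup E l then (1 : ℂ) else 0) =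
      if x ∉ powSubgroup E l then 1 else 0 := fun l => by split_ifs <;> simp
  simp only [primitiveIndicator, h, Finset.prod_ite_zero, Finset.prod_const_one]
  congr

lemma isFree_of_notMem_powSubgroup {x : Eˣ}
    (h : ∀ l ∈ (Fintype.card E - 1).primeFactors, Additive.ofMul x ∉ powSubgroup E l) :
    IsFree (Fintype.card E - 1) (x : E) := by
  refine ⟨x.ne_zero, fun d hd ⟨b, hb⟩ => ?_⟩
  by_contra hd1
  obtain ⟨l, hl, k, rfl⟩ := Nat.exists_prime_and_dvd hd1
  have hc : Fintype.card E - 1 ≠ 0 := by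
    have := Fintype.one_lt_card (α := E)
    omega
  refine h l (Nat.mem_primeFactors.2 ⟨hl, (dvd_mul_right l k).trans hd, hc⟩) ?_
  have hb0 : b ≠ 0 := by
    rintro rfl
    have hlk : l * k ≠ 0 := by
      rintro h0
      exact hc (Nat.eq_zero_of_zero_dvd (h0 ▸ hd))
    exact x.ne_zero (by rw [hb, zero_pow hlk])
  refine mem_powSubgroup.2 ⟨Units.mk0 b hb0 ^ k, Units.ext ?_⟩
  simp [hb, ← pow_mul, mul_comm k l]

lemma fourierMultBound_primitiveIndicator :
    FourierMultBound (primitiveIndicator E)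
      (2 ^ (Fintype.card E - 1).primeFactors.card *
        ∏ l ∈ (Fintype.card E - 1).primeFactors, (1 - (l : ℝ)⁻¹)) := by
  rw [← Finset.prod_const, ← Finset.prod_mul_distrib]
  refine FourierMultBound.prod _ fun l hl => ?_
  have := FourierMultBound.one_sub_indicator (powSubgroup E l)
  rwa [index_powSubgroup (Nat.dvd_of_mem_primeFactors hl)] at this

lemma sum_primitiveIndicator :
    ∑ x, primitiveIndicator E x = ((Fintype.card E - 1 : ℕ) : ℂ) *
      ∏ l ∈ (Fintype.card E - 1).primeFactors, (1 - (l : ℂ)⁻¹) := by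
  have h := sum_prod_indicator (Fintype.card E - 1).primeFactors (powSubgroup E)
    (fun t ht => index_iInf_of_pairwise_coprime t _ fun i hi j hj hij => by
      have hi := ht hi
      have hj := ht hj
      simp only [index_powSubgroup (Nat.dvd_of_mem_primeFactors hi),
        index_powSubgroup (Nat.dvd_of_mem_primeFactors hj)]
      exact (Nat.coprime_primes (Nat.prime_of_mem_primeFactors hi)
        (Nat.prime_of_mem_primeFactors hj)).2 hij) (fun _ => 1) (fun _ => -1)
  have hc : Fintype.card (Additive Eˣ) = Fintype.card E - 1 := by
    rw [← Fintype.card_units]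
    exact Fintype.card_congr Additive.toMul
  rw [hc, Finset.prod_congr rfl fun l hl => by
    rw [index_powSubgroup (Nat.dvd_of_mem_primeFactors hl)]] at h
  simpa only [primitiveIndicator, neg_one_mul, ← sub_eq_add_neg] using h

lemma Wnat_eq {m : ℕ} (hm : m ≠ 0) : Wnat m = 2 ^ m.primeFactors.card := by
  have h : Wnat m = (m.divisors.filter Squarefree).card := by
    rw [Wnat]
    exact Nat.subtype_card _ fun d => by simp [hm]
  have h2 := Nat.sum_divisors_filter_squarefree hm (f := fun _ => 1)
  rw [Finset.sum_const, Finset.sum_const, smul_eq_mul, smul_eq_mul, mul_one, mul_one,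
    Finset.card_powerset] at h2
  rw [h, h2, Nat.factors_eq]
  rfl

end Multiplicative

lemma frobenius_toLinearMap_pow {F E : Type*} [Field F] [Fintype F] [Field E] [Algebra F E] (i : ℕ)
    (a : E) :
    ((FiniteField.frobeniusAlgHom F E).toLinearMap ^ i) a = a ^ Fintype.card F ^ i := by
  induction i generalizing a with
  | zero => simp
  | succ i ih => rw [pow_succ, Module.End.mul_apply, ih]; simp [← pow_mul, pow_succ']

section Linearized

variable (F E : Type*) [Field F] [Fintype F] [Field E] [Fintype E] [Algebra F E]

/-- The `F`-linear endomorphism of `E` given by the linearized associate of `P`. -/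
def assocEnd (P : F[X]) : E →ₗ[F] E := aeval (FiniteField.frobeniusAlgHom F E).toLinearMap P

variable {F} in
/-- The additive subgroup of the values of the linearized associate of `P`. -/
def assocRange (P : F[X]) : AddSubgroup E := (assocEnd F E P).toAddMonoidHom.range

variable {F E}

lemma mem_assocRange {P : F[X]} {a : E} : a ∈ assocRange E P ↔ ∃ b, assocEnd F E P b = a :=
  Iff.rfl

lemma assocEnd_apply (P : F[X]) (a : E) : assocEnd F E P a = Lf (Fintype.card F) P a := by
  rw [assocEnd, aeval_eq_sum_range, LinearMap.sum_apply, Lf]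
  refine Finset.sum_congr rfl fun i _ => ?_
  rw [LinearMap.smul_apply, frobenius_toLinearMap_pow, Algebra.smul_def]

lemma assocEnd_mul (P Q : F[X]) (a : E) :
    assocEnd F E (P * Q) a = assocEnd F E P (assocEnd F E Q a) := by
  simp [assocEnd]

lemma assocEnd_add (P Q : F[X]) (a : E) :
    assocEnd F E (P + Q) a = assocEnd F E P a + assocEnd F E Q a := by
  simp [assocEnd]

lemma assocEnd_one (a : E) : assocEnd F E 1 a = a := by
  simp [assocEnd]

lemma assocEnd_X_pow_sub_one :
    assocEnd F E (X ^ Module.finrank F E - 1) = 0 := by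
  rw [assocEnd, ← FiniteField.minpoly_frobeniusAlgHom, minpoly.aeval]

lemma card_ker_assocEnd_le {P : F[X]} (hP : P ≠ 0) :
    Nat.card (LinearMap.ker (assocEnd F E P)) ≤ Fintype.card F ^ P.natDegree := by
  classical
  have hq : 1 < Fintype.card F := Fintype.one_lt_card
  set R : E[X] := ∑ i ∈ Finset.range (P.natDegree + 1),
    C (algebraMap F E (P.coeff i)) * X ^ Fintype.card F ^ i with hR
  have hcoeff : R.coeff (Fintype.card F ^ P.natDegree) = algebraMap F E P.leadingCoeff := by
    rw [hR, finsetSum_coeff, Finset.sum_eq_single P.natDegree]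
    · simp
    · intro i _ hi
      rw [coeff_C_mul, coeff_X_pow, if_neg, mul_zero]
      exact fun h => hi (Nat.pow_right_injective hq h).symm
    · simp
  have hR0 : R ≠ 0 := by
    intro h
    rw [h, coeff_zero, eq_comm, map_eq_zero, leadingCoeff_eq_zero] at hcoeff
    exact hP hcoeff
  have hdeg : R.natDegree ≤ Fintype.card F ^ P.natDegree := by
    refine natDegree_sum_le_of_forall_le _ _ fun i hi => ?_
    refine (natDegree_C_mul_X_pow_le _ _).trans (Nat.pow_le_pow_right hq.le ?_)
    exact Nat.lt_succ_iff.1 (Finset.mem_range.1 hi)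
  rw [Nat.card_eq_fintype_card, Fintype.card_subtype]
  refine le_trans (card_le_degree_of_subset_roots (p := R) fun a ha => ?_) hdeg
  rw [mem_roots hR0, IsRoot, hR, eval_finsetSum]
  simpa [assocEnd_apply, Lf] using ha

lemma natCard_ker_assocEnd {P : F[X]} (hP : P ∣ X ^ Module.finrank F E - 1) :
    Nat.card (LinearMap.ker (assocEnd F E P)) = Fintype.card F ^ P.natDegree := by
  have h0 : (X ^ Module.finrank F E - 1 : F[X]) ≠ 0 := X_pow_sub_C_ne_zero Module.finrank_pos 1
  obtain ⟨Q, hQ⟩ := hP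
  have hP0 : P ≠ 0 := by rintro rfl; simp [hQ] at h0
  have hQ0 : Q ≠ 0 := by rintro rfl; simp [hQ] at h0
  have hdeg : P.natDegree + Q.natDegree = Module.finrank F E := by
    rw [← natDegree_mul hP0 hQ0, ← hQ]
    exact natDegree_X_pow_sub_C
  refine le_antisymm (card_ker_assocEnd_le hP0) ?_
  have hq : 0 < Fintype.card F := Fintype.card_pos
  have hle : LinearMap.range (assocEnd F E P) ≤ LinearMap.ker (assocEnd F E Q) := by
    rintro _ ⟨a, rfl⟩
    rw [LinearMap.mem_ker, ← assocEnd_mul, mul_comm, ← hQ, assocEnd_X_pow_sub_one,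
      LinearMap.zero_apply]
  have h1 : Nat.card (LinearMap.range (assocEnd F E P)) ≤ Fintype.card F ^ Q.natDegree :=
    (Nat.card_le_card_of_injective _ (Submodule.inclusion_injective hle)).trans
      (card_ker_assocEnd_le hQ0)
  have h2 : Nat.card (LinearMap.range (assocEnd F E P)) *
      Nat.card (LinearMap.ker (assocEnd F E P)) =
      Fintype.card F ^ P.natDegree * Fintype.card F ^ Q.natDegree := by
    rw [← pow_add, hdeg, ← Module.card_eq_pow_finrank (K := F) (V := E), ← Nat.card_eq_fintype_card,
      mul_comm]
    have h3 := (assocEnd F E P).toAddMonoidHom.ker.card_mul_index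
    rw [AddSubgroup.index_ker] at h3
    exact h3
  by_contra! hlt
  have h3 := Nat.mul_lt_mul_of_le_of_lt h1 hlt (by positivity)
  rw [h2, mul_comm] at h3
  exact lt_irrefl _ h3

lemma index_assocRange {P : F[X]} (hP : P ∣ X ^ Module.finrank F E - 1) :
    (assocRange E P).index = Fintype.card F ^ P.natDegree := by
  rw [assocRange, AddSubgroup.index_range, ← natCard_ker_assocEnd hP]
  rfl

lemma assocRange_mul {P Q : F[X]} (h : IsCoprime P Q) :
    assocRange E (P * Q) = assocRange E P ⊓ assocRange E Q := by
  ext a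
  simp only [AddSubgroup.mem_inf, mem_assocRange]
  constructor
  · rintro ⟨b, rfl⟩
    exact ⟨⟨_, (assocEnd_mul P Q b).symm⟩, ⟨_, by rw [mul_comm, assocEnd_mul]⟩⟩
  · rintro ⟨⟨b, hb⟩, ⟨c, hc⟩⟩
    obtain ⟨u, v, huv⟩ := h
    refine ⟨assocEnd F E u c + assocEnd F E v b, ?_⟩
    have h1 : assocEnd F E (u * P + v * Q) a = a := by rw [huv, assocEnd_one]
    rw [assocEnd_add] at h1
    have h2 : assocEnd F E (u * P) a = assocEnd F E (P * Q * u) c := by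
      rw [← hc, ← assocEnd_mul]; congr 2; ring
    have h3 : assocEnd F E (v * Q) a = assocEnd F E (P * Q * v) b := by
      rw [← hb, ← assocEnd_mul]; congr 2; ring
    rw [map_add, ← assocEnd_mul, ← assocEnd_mul, ← h2, ← h3, h1]

lemma iInf_assocRange (t : Finset F[X]) (h : (t : Set F[X]).Pairwise IsCoprime) :
    ⨅ P ∈ t, assocRange E P = assocRange E (∏ P ∈ t, P) := by
  classical
  induction t using Finset.induction_on with
  | empty =>
    rw [Finset.prod_empty, eq_comm]
    simp only [Finset.notMem_empty, iInf_false, iInf_top, eq_top_iff]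
    exact fun a _ => ⟨a, assocEnd_one a⟩
  | insert P t hP ih =>
    rw [Finset.iInf_insert, Finset.prod_insert hP, ih (h.mono (by simp)), assocRange_mul]
    exact IsCoprime.prod_right fun Q hQ => h (by simp) (by simp [hQ]) fun h => hP (h ▸ hQ)

lemma index_iInf_assocRange (t : Finset F[X]) (h : (t : Set F[X]).Pairwise IsCoprime)
    (hd : ∀ P ∈ t, P ∣ X ^ Module.finrank F E - 1) :
    (⨅ P ∈ t, assocRange E P).index = ∏ P ∈ t, (assocRange E P).index := by
  have hp : ∏ P ∈ t, P ∣ X ^ Module.finrank F E - 1 := Finset.prod_dvd_of_coprime h hd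
  have h0 : (X ^ Module.finrank F E - 1 : F[X]) ≠ 0 := X_pow_sub_C_ne_zero Module.finrank_pos 1
  rw [iInf_assocRange t h, index_assocRange hp,
    Finset.prod_congr rfl fun P hP => index_assocRange (hd P hP), Finset.prod_pow_eq_pow_sum,
    natDegree_prod _ _ fun P hP => ne_zero_of_dvd_ne_zero h0 (hd P hP)]

end Linearized

open Classical in
lemma sum_sieve_indicator {A ι : Type*} [AddCommGroup A] [Fintype A] [DecidableEq ι]
    {s t : Finset ι} (hst : Disjoint s t) (H : ι → AddSubgroup A)
    (hH : ∀ r ⊆ s ∪ t, (⨅ i ∈ r, H i).index = ∏ i ∈ r, (H i).index) :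
    ∑ a, (∏ i ∈ s, (1 - if a ∈ H i then 1 else 0)) * (1 - ∑ j ∈ t, if a ∈ H j then 1 else 0) =
      (Fintype.card A : ℂ) * ((∏ i ∈ s, (1 - ((H i).index : ℂ)⁻¹)) *
        (1 - ∑ j ∈ t, ((H j).index : ℂ)⁻¹)) := by
  have h1 := sum_prod_indicator s H (fun r hr => hH r (hr.trans Finset.subset_union_left))
    (fun _ => 1) (fun _ => -1)
  simp only [neg_one_mul, ← sub_eq_add_neg] at h1
  have h2 : ∀ j ∈ t, ∑ a, (∏ i ∈ s, (1 - if a ∈ H i then (1 : ℂ) else 0)) *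
      (if a ∈ H j then 1 else 0) =
      (Fintype.card A : ℂ) * ((∏ i ∈ s, (1 - ((H i).index : ℂ)⁻¹)) * ((H j).index : ℂ)⁻¹) := by
    intro j hj
    have hjs : j ∉ s := fun h => Finset.disjoint_left.1 hst h hj
    have h := sum_prod_indicator (insert j s) H
      (fun r hr => hH r (hr.trans (Finset.insert_subset (Finset.mem_union_right _ hj)
        Finset.subset_union_left)))
      (fun i => if i = j then 0 else 1) (fun i => if i = j then 1 else -1)
    have hne : ∀ i ∈ s, i ≠ j := fun i hi h => hjs (h ▸ hi)
    simp only [Finset.prod_insert hjs, if_true, zero_add, one_mul] at h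
    rw [Finset.prod_congr rfl (g := fun i => 1 - ((H i).index : ℂ)⁻¹) fun i hi => by
      rw [if_neg (hne i hi), if_neg (hne i hi)]; ring] at h
    rw [mul_comm (∏ i ∈ s, _), ← h]
    refine Finset.sum_congr rfl fun a _ => ?_
    rw [mul_comm]
    congr 1
    refine Finset.prod_congr rfl fun i hi => ?_
    rw [if_neg (hne i hi), if_neg (hne i hi)]; ring
  simp_rw [mul_sub, mul_one, Finset.sum_sub_distrib, Finset.mul_sum]
  rw [h1, Finset.sum_comm, Finset.sum_congr rfl h2]

section Combination

open scoped Classical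

variable {E : Type*} [Field E]

/-- Extension by zero of a function on the units. -/
def unitsExtend (h : Additive Eˣ → ℂ) (b : E) : ℂ :=
  if hb : b ≠ 0 then h (Additive.ofMul (Units.mk0 b hb)) else 0

lemma unitsExtend_coe (h : Additive Eˣ → ℂ) (x : Additive Eˣ) :
    unitsExtend h (x.toMul : E) = h x := by
  rw [unitsExtend, dif_pos x.toMul.ne_zero, Units.mk0_val, ofMul_toMul]

lemma unitsExtend_zero (h : Additive Eˣ → ℂ) : unitsExtend h 0 = 0 := by
  simp [unitsExtend]

/-- The multiplicative character extending a character of the group of units. -/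
def AddChar.toMulChar (ψ : AddChar (Additive Eˣ) ℂ) : MulChar E ℂ :=
  MulChar.ofUnitHom (MonoidHom.toHomUnits
    { toFun := fun x => ψ (Additive.ofMul x)
      map_one' := by simp
      map_mul' := fun x y => by simp [AddChar.map_add_eq_mul] })

lemma AddChar.toMulChar_eq (ψ : AddChar (Additive Eˣ) ℂ) (b : E) :
    ψ.toMulChar b = unitsExtend ψ b := by
  by_cases hb : b = 0
  · subst hb
    rw [unitsExtend_zero, MulChar.map_zero]
  · obtain ⟨x, rfl⟩ : ∃ x : Eˣ, (x : E) = b := ⟨Units.mk0 _ hb, rfl⟩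
    have h := unitsExtend_coe ψ (Additive.ofMul x)
    rw [toMul_ofMul] at h
    rw [h, AddChar.toMulChar, MulChar.ofUnitHom_coe]
    rfl

variable [Fintype E]

lemma sum_fiber_mul (L w : E → _) (h : Additive Eˣ → ℂ) :
    ∑ x : Additive Eˣ, (∑ a : E, if L a = (x.toMul : E) then w a else 0) * h x =
      ∑ a, unitsExtend h (L a) * w a := by
  simp_rw [Finset.sum_mul]
  rw [Finset.sum_comm]
  refine Finset.sum_congr rfl fun a _ => ?_
  by_cases ha : L a = 0
  · rw [ha, unitsExtend_zero, zero_mul]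
    refine Finset.sum_eq_zero fun x _ => ?_
    rw [if_neg x.toMul.ne_zero.symm, zero_mul]
  · obtain ⟨x, hx⟩ : ∃ x : Additive Eˣ, (x.toMul : E) = L a :=
      ⟨Additive.ofMul (Units.mk0 _ ha), rfl⟩
    rw [← hx, unitsExtend_coe, Finset.sum_eq_single x]
    · rw [if_pos rfl, mul_comm]
    · intro y _ hy
      rw [if_neg fun h => hy ?_, zero_mul]
      exact Additive.toMul.injective (Units.ext h.symm)
    · simp

lemma norm_sum_primitiveIndicator_sub_le (L : E →+ E) {w : E → ℂ} {C : ℝ}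
    (hw : FourierMultBound w C) :
    ‖∑ a, unitsExtend (primitiveIndicator E) (L a) * w a -
      (∏ l ∈ (Fintype.card E - 1).primeFactors, (1 - (l : ℂ)⁻¹)) * ∑ a, w a‖ ≤
      2 ^ (Fintype.card E - 1).primeFactors.card *
        (∏ l ∈ (Fintype.card E - 1).primeFactors, (1 - (l : ℝ)⁻¹)) *
        (C * (Nat.card L.ker * √(Fintype.card E))) := by
  have hN : ((Fintype.card E - 1 : ℕ) : ℂ) ≠ 0 := by
    have := Fintype.one_lt_card (α := E)
    exact_mod_cast (by omega : Fintype.card E - 1 ≠ 0)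
  have hc : Fintype.card (Additive Eˣ) = Fintype.card E - 1 := by
    rw [← Fintype.card_units]
    exact Fintype.card_congr Additive.toMul
  set M := ∑ a, w a with hM
  have key := fourierMultBound_primitiveIndicator (E := E)
    (fun x => (∑ a, if L a = (x.toMul : E) then w a else 0) - M / (Fintype.card E - 1 : ℕ))
    (C * (Nat.card L.ker * √(Fintype.card E))) ?_ 1
  · convert key using 2
    simp only [AddChar.one_apply, mul_one, sub_mul, Finset.sum_sub_distrib]
    rw [sum_fiber_mul, ← Finset.mul_sum, sum_primitiveIndicator]
    field_simp
  intro ψ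
  simp only [sub_mul, Finset.sum_sub_distrib]
  rw [sum_fiber_mul, ← Finset.mul_sum, AddChar.sum_eq_ite, hc]
  by_cases hψ : ψ = 0
  · rw [if_pos hψ, div_mul_cancel₀ _ hN]
    have h1 : ∑ a, unitsExtend ψ (L a) * w a - M =
        -∑ a, (if a ∈ L.ker then 1 else 0) * w a * (1 : AddChar E ℂ) a := by
      rw [hM, ← Finset.sum_sub_distrib, ← Finset.sum_neg_distrib]
      refine Finset.sum_congr rfl fun a _ => ?_
      by_cases ha : L a = 0 <;> simp [hψ, unitsExtend, AddMonoidHom.mem_ker, ha]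
    rw [h1, norm_neg]
    refine hw _ _ (fun η => ?_) 1
    have h2 : ‖∑ a, (if a ∈ L.ker then 1 else 0) * η a‖ ≤ Nat.card L.ker := by
      simp only [ite_mul, one_mul, zero_mul]
      rw [← Finset.sum_filter]
      refine (norm_sum_le _ _).trans ?_
      simp only [AddChar.norm_apply, Finset.sum_const, nsmul_eq_mul, mul_one]
      rw [Nat.card_eq_fintype_card, Fintype.card_subtype]
    refine h2.trans (le_mul_of_one_le_right (by positivity) ?_)
    rw [Real.one_le_sqrt]
    exact_mod_cast Fintype.card_pos
  · rw [if_neg hψ, mul_zero, sub_zero]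
    have hχ : ψ.toMulChar ≠ 1 := by
      intro h
      refine hψ (DFunLike.ext _ _ fun x => ?_)
      rw [← unitsExtend_coe ψ x, ← AddChar.toMulChar_eq, h]
      simp
    have h := hw (fun a => ψ.toMulChar (L a)) _ (norm_sum_mulChar_comp_mul_addChar_le hχ L) 1
    simpa [AddChar.toMulChar_eq] using h

lemma exists_isFree_and_notMem (L : E →+ E) {ι : Type*} [DecidableEq ι] {s t : Finset ι}
    (hst : Disjoint s t) (H : ι → AddSubgroup E) {k : ℕ}
    (hH : ∀ r ⊆ s ∪ t, (⨅ i ∈ r, H i).index = ∏ i ∈ r, (H i).index)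
    (hs : ∀ i ∈ s, (H i).index ≠ 1) (hk : ∀ i ∈ t, (H i).index = k) (ht : t.card ≤ k)
    (hlt : 2 ^ (Fintype.card E - 1).primeFactors.card * 2 ^ s.card *
      (1 - t.card / k + t.card * (1 - (k : ℝ)⁻¹)) * (Nat.card L.ker * √(Fintype.card E)) <
        Fintype.card E * (1 - t.card / k : ℝ)) :
    ∃ a, IsFree (Fintype.card E - 1) (L a) ∧ ∀ i ∈ s ∪ t, a ∉ H i := by
  set θ := ∏ l ∈ (Fintype.card E - 1).primeFactors, (1 - (l : ℝ)⁻¹) with hθ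
  set δ := ∏ i ∈ s, (1 - ((H i).index : ℝ)⁻¹) with hδ
  have hθ0 : 0 < θ := Finset.prod_pos fun l hl => by
    have : (1 : ℝ) < l := by exact_mod_cast (Nat.prime_of_mem_primeFactors hl).one_lt
    exact sub_pos.2 (inv_lt_one_of_one_lt₀ this)
  have hδ0 : 0 < δ := Finset.prod_pos fun i hi => by
    have h0 : (H i).index ≠ 0 := AddSubgroup.index_ne_zero_of_finite
    have : (1 : ℝ) < (H i).index := by
      have := hs i hi
      exact_mod_cast (by omega : 1 < (H i).index)
    exact sub_pos.2 (inv_lt_one_of_one_lt₀ this)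
  have hw := (FourierMultBound.prod s fun i _ => FourierMultBound.one_sub_indicator (H i)).mul
    (FourierMultBound.one_sub_sum_indicator t H hk ht)
  have hb := norm_sum_primitiveIndicator_sub_le L hw
  rw [sum_sieve_indicator hst H hH, Finset.prod_mul_distrib, Finset.prod_const] at hb
  have hsum : ∑ j ∈ t, ((H j).index : ℂ)⁻¹ = t.card / k := by
    rw [Finset.sum_congr rfl fun j hj => by rw [hk j hj], Finset.sum_const, nsmul_eq_mul,
      div_eq_mul_inv]
  rw [hsum, ← hδ, ← hθ] at hb
  have hmain : (∏ l ∈ (Fintype.card E - 1).primeFactors, (1 - (l : ℂ)⁻¹)) *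
      ((Fintype.card E : ℂ) * ((∏ i ∈ s, (1 - ((H i).index : ℂ)⁻¹)) * (1 - t.card / k))) =
      ((θ * (Fintype.card E * (δ * (1 - t.card / k))) : ℝ) : ℂ) := by
    rw [hθ, hδ]; push_cast; rfl
  rw [hmain] at hb
  by_contra! hcon
  have hre : (∑ a, unitsExtend (primitiveIndicator E) (L a) *
      ((∏ i ∈ s, (1 - if a ∈ H i then 1 else 0)) *
        (1 - ∑ j ∈ t, if a ∈ H j then 1 else 0))).re ≤ 0 := by
    rw [Complex.re_sum]
    refine Finset.sum_nonpos fun a _ => ?_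
    have h1 : ∀ i, (1 - if a ∈ H i then (1 : ℂ) else 0) = if a ∉ H i then 1 else 0 :=
      fun i => by split_ifs <;> simp
    simp only [h1, Finset.prod_ite_zero, Finset.prod_const_one]
    by_cases hLa : L a = 0
    · rw [hLa, unitsExtend_zero, zero_mul, Complex.zero_re]
    · rw [unitsExtend, dif_pos hLa, primitiveIndicator_eq]
      split_ifs with h2 h3
      · obtain ⟨i, hi, hai⟩ := hcon a (isFree_of_notMem_powSubgroup h2)
        have hit : i ∈ t := (Finset.mem_union.1 hi).resolve_left fun h => h3 i h hai
        rw [one_mul, one_mul, Finset.sum_boole]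
        have hpos : 1 ≤ (t.filter fun j => a ∈ H j).card :=
          Finset.card_pos.2 ⟨i, Finset.mem_filter.2 ⟨hit, hai⟩⟩
        have : (1 : ℝ) ≤ (t.filter fun j => a ∈ H j).card := by exact_mod_cast hpos
        simpa using this
      all_goals simp
  have h4 := (Complex.re_le_norm _).trans ((norm_sub_rev _ _).trans_le hb)
  rw [Complex.sub_re, Complex.ofReal_re] at h4
  have h5 := mul_lt_mul_of_pos_left hlt (mul_pos hθ0 hδ0)
  nlinarith [h4, h5, hre]

end Combination

lemma exists_notMem_of_independent {A ι : Type*} [AddCommGroup A] [Fintype A] (s : Finset ι)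
    (H : ι → AddSubgroup A)
    (hH : ∀ t ⊆ s, (⨅ i ∈ t, H i).index = ∏ i ∈ t, (H i).index)
    (hs : ∀ i ∈ s, (H i).index ≠ 1) : ∃ a, ∀ i ∈ s, a ∉ H i := by
  classical
  have h := sum_prod_indicator s H hH (fun _ => 1) (fun _ => -1)
  have h0 : (Fintype.card A : ℂ) * ∏ i ∈ s, (1 + -1 * ((H i).index : ℂ)⁻¹) ≠ 0 := by
    refine mul_ne_zero (by exact_mod_cast Fintype.card_ne_zero)
      (Finset.prod_ne_zero_iff.2 fun i hi => ?_)
    rw [neg_one_mul, ← sub_eq_add_neg, sub_ne_zero, ne_comm, ne_eq, inv_eq_one]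
    exact_mod_cast hs i hi
  rw [← h] at h0
  obtain ⟨a, _, ha⟩ := Finset.exists_ne_zero_of_sum_ne_zero h0
  refine ⟨a, fun i hi hai => ?_⟩
  have := Finset.prod_ne_zero_iff.1 ha i hi
  simp [hai] at this

section FactorSets

variable {F : Type*} [Field F]

open Classical in
/-- The monic irreducible factors of a polynomial. -/
def monicFactors (g : F[X]) : Finset F[X] :=
  (UniqueFactorizationMonoid.normalizedFactors g).toFinset

lemma mem_monicFactors {g P : F[X]} (hg : g ≠ 0) :
    P ∈ monicFactors g ↔ Irreducible P ∧ P.Monic ∧ P ∣ g := by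
  classical
  rw [monicFactors, Multiset.mem_toFinset]
  convert Polynomial.mem_normalizedFactors_iff hg

lemma pairwise_isCoprime_of_irreducible_of_monic {s : Set F[X]}
    (h : ∀ P ∈ s, Irreducible P ∧ P.Monic) : s.Pairwise IsCoprime := by
  intro P hP Q hQ hne
  refine ((h P hP).1.coprime_iff_not_dvd).2 fun hd => hne ?_
  exact eq_of_monic_of_associated (h P hP).2 (h Q hQ).2
    ((h P hP).1.associated_of_dvd (h Q hQ).1 hd)

lemma card_linear_add_two_mul_card_nonlinear_le {g : F[X]} (hg : g ≠ 0) :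
    ((monicFactors g).filter (·.natDegree = 1)).card +
      2 * ((monicFactors g).filter (¬ ·.natDegree = 1)).card ≤ g.natDegree := by
  have hd : ∏ P ∈ monicFactors g, P ∣ g :=
    Finset.prod_dvd_of_coprime (pairwise_isCoprime_of_irreducible_of_monic fun P hP =>
      let h := (mem_monicFactors hg).1 hP
      ⟨h.1, h.2.1⟩) fun P hP => ((mem_monicFactors hg).1 hP).2.2
  refine le_trans ?_ (natDegree_le_of_dvd hd hg)
  rw [natDegree_prod _ _ fun P hP => ((mem_monicFactors hg).1 hP).1.ne_zero,
    ← Finset.sum_filter_add_sum_filter_not _ (fun P : F[X] => P.natDegree = 1)]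
  refine add_le_add ?_ ?_
  · rw [Finset.card_eq_sum_ones]
    exact Finset.sum_le_sum fun P hP => (Finset.mem_filter.1 hP).2.ge
  · rw [mul_comm, ← smul_eq_mul]
    refine Finset.card_nsmul_le_sum _ _ _ fun P hP => ?_
    have h1 := (Finset.mem_filter.1 hP).2
    have h2 := ((mem_monicFactors hg).1 (Finset.mem_filter.1 hP).1).1.natDegree_pos
    omega

lemma card_linear_le [Fintype F] {p q e α n₀ n : ℕ} (hp : p.Prime) (he : 0 < e) (hq : q = p ^ e)
    (hF : Fintype.card F = q) (hn : n = p ^ α * n₀) (hn0 : n ≠ 0)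
    (h0 : 0 < Nat.gcd (q - 1) n₀) {g : F[X]}
    (hg0 : g ≠ 0) (hg : g ∣ X ^ n - 1) :
    ((monicFactors g).filter (·.natDegree = 1)).card ≤ Nat.gcd (q - 1) n₀ := by
  classical
  have hroots : (nthRootsFinset (Nat.gcd (q - 1) n₀) (1 : F)).card ≤ Nat.gcd (q - 1) n₀ :=
    (Multiset.toFinset_card_le _).trans (card_nthRoots _ _)
  refine (Finset.card_le_card_of_injOn (fun P => -P.coeff 0) ?_ ?_).trans hroots
  · intro P hP
    obtain ⟨hPg, hP1⟩ := Finset.mem_filter.1 hP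
    obtain ⟨_, hmon, hdvd⟩ := (mem_monicFactors hg0).1 hPg
    rw [Finset.mem_coe, mem_nthRootsFinset h0]
    set a := -P.coeff 0 with ha
    have hroot : P.eval a = 0 := by
      rw [hmon.eq_X_add_C hP1]; simp [ha]
    have han : a ^ n = 1 := by
      have h := eval_dvd (x := a) (hdvd.trans hg)
      rw [hroot, zero_dvd_iff] at h
      simpa [sub_eq_zero] using h
    have ha0 : a ≠ 0 := by
      rintro h
      rw [h, zero_pow hn0] at han
      exact zero_ne_one han
    have haq : a ^ (q - 1) = 1 := by
      rw [← hF]; exact FiniteField.pow_card_sub_one_eq_one a ha0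
    have hcop : (orderOf a).Coprime (p ^ α) := by
      refine Nat.Coprime.pow_right _ (Nat.Coprime.symm ((Nat.Prime.coprime_iff_not_dvd hp).2 ?_))
      intro hpa
      have h1 : p ∣ q - 1 := hpa.trans (orderOf_dvd_of_pow_eq_one haq)
      have h2 : p ∣ q := hq ▸ dvd_pow_self p he.ne'
      have h3 : 1 ≤ q := hq ▸ Nat.one_le_pow _ _ hp.pos
      have := (Nat.dvd_sub_iff_right h3 h2).1 h1
      exact hp.one_lt.ne' (Nat.dvd_one.1 this)
    exact orderOf_dvd_iff_pow_eq_one.1 (Nat.dvd_gcd (orderOf_dvd_of_pow_eq_one haq)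
      (hcop.dvd_of_dvd_mul_left (hn ▸ orderOf_dvd_of_pow_eq_one han)))
  · intro P hP Q hQ hPQ
    obtain ⟨hPg, hP1⟩ := Finset.mem_filter.1 hP
    obtain ⟨hQg, hQ1⟩ := Finset.mem_filter.1 hQ
    rw [((mem_monicFactors hg0).1 hPg).2.1.eq_X_add_C hP1,
      ((mem_monicFactors hg0).1 hQg).2.1.eq_X_add_C hQ1, neg_injective hPQ]

end FactorSets

section Linearized

variable {F E : Type*} [Field F] [Fintype F] [Field E] [Fintype E] [Algebra F E]

lemma isPolyFree_of_notMem_assocRange {T : F[X]} {a : E}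
    (h : ∀ P : F[X], Irreducible P → P.Monic → P ∣ T → a ∉ assocRange E P) :
    IsPolyFree (Fintype.card F) T a := by
  rintro g hg hgT ⟨b, rfl⟩
  by_contra hg1
  obtain ⟨P, hPm, hPi, Q, rfl⟩ :=
    exists_monic_irreducible_factor g fun hu => hg1 (hg.eq_one_of_isUnit hu)
  refine h P hPi hPm ((dvd_mul_right P Q).trans hgT) ⟨assocEnd F E Q b, ?_⟩
  rw [← assocEnd_apply, assocEnd_mul]
  rfl

lemma assocEnd_mem_assocRange {P Q : F[X]} (h : P ∣ Q) (a : E) :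
    assocEnd F E Q a ∈ assocRange E P := by
  obtain ⟨R, rfl⟩ := h
  exact ⟨_, (assocEnd_mul P R a).symm⟩

lemma one_ne_index_assocRange {P : F[X]} (hP : Irreducible P)
    (hd : P ∣ X ^ Module.finrank F E - 1) : (assocRange E P).index ≠ 1 := by
  rw [index_assocRange hd]
  exact (Nat.one_lt_pow hP.natDegree_pos.ne' Fintype.one_lt_card).ne'

/-- An element that is `g`-free can be changed modulo the kernel of `L_f` into an element that is
`f * g`-free. -/
lemma exists_isPolyFree_of_notMem {f g : F[X]} (hfg : f * g = X ^ Module.finrank F E - 1) {a : E}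
    (ha : ∀ P ∈ monicFactors g, a ∉ assocRange E P) :
    ∃ b, IsPolyFree (Fintype.card F) (X ^ Module.finrank F E - 1 : F[X]) b ∧
      assocEnd F E f b = assocEnd F E f a := by
  classical
  have h0 : (X ^ Module.finrank F E - 1 : F[X]) ≠ 0 := X_pow_sub_C_ne_zero Module.finrank_pos 1
  have hf0 : f ≠ 0 := by rintro rfl; simp [← hfg] at h0
  have hg0 : g ≠ 0 := by rintro rfl; simp [← hfg] at h0
  set T := (monicFactors f).filter fun P => ¬ P ∣ g with hT
  have hTf : ∀ P ∈ T, Irreducible P ∧ P.Monic ∧ P ∣ f := fun P hP =>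
    (mem_monicFactors hf0).1 (Finset.mem_filter.1 hP).1
  have hTd : ∀ P ∈ T, P ∣ X ^ Module.finrank F E - 1 := fun P hP =>
    hfg ▸ (hTf P hP).2.2.mul_right g
  have hTc : (T : Set F[X]).Pairwise IsCoprime :=
    pairwise_isCoprime_of_irreducible_of_monic fun P hP => ⟨(hTf P hP).1, (hTf P hP).2.1⟩
  obtain ⟨c, hc⟩ := exists_notMem_of_independent T (assocRange E)
    (fun r hr => index_iInf_assocRange r (hTc.mono (by exact_mod_cast hr)) fun P hP =>
      hTd P (hr hP)) (fun P hP => one_ne_index_assocRange (hTf P hP).1 (hTd P hP))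
  have hcop : IsCoprime g (∏ P ∈ T, P) := IsCoprime.prod_right fun P hP =>
    (((hTf P hP).1.coprime_iff_not_dvd).2 (Finset.mem_filter.1 hP).2).symm
  obtain ⟨u, v, huv⟩ := hcop
  have hsplit : ∀ x : E, assocEnd F E (u * g) x + assocEnd F E (v * ∏ P ∈ T, P) x = x := fun x => by
    rw [← assocEnd_add, huv, assocEnd_one]
  refine ⟨assocEnd F E (u * g) c + assocEnd F E (v * ∏ P ∈ T, P) a,
    isPolyFree_of_notMem_assocRange fun P hPi hPm hPd hmem => ?_, ?_⟩
  · by_cases hPg : P ∣ g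
    · refine ha P ((mem_monicFactors hg0).2 ⟨hPi, hPm, hPg⟩) ?_
      rw [← hsplit a]
      have hu := fun x => assocEnd_mem_assocRange (E := E) (hPg.mul_left u) x
      exact add_mem (hu a) ((add_mem_cancel_left (hu c)).1 hmem)
    · have hPf : P ∣ f := (hPi.prime.dvd_or_dvd (hfg ▸ hPd)).resolve_right hPg
      have hPT : P ∈ T := Finset.mem_filter.2 ⟨(mem_monicFactors hf0).2 ⟨hPi, hPm, hPf⟩, hPg⟩
      refine hc P hPT ?_
      rw [← hsplit c]
      have hv := fun x => assocEnd_mem_assocRange (E := E)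
        ((Finset.dvd_prod_of_mem (fun P => P) hPT).mul_left v) x
      exact add_mem ((add_mem_cancel_right (hv a)).1 hmem) (hv c)
  · have hker : ∀ x, assocEnd F E f (assocEnd F E (u * g) x) = 0 := fun x => by
      rw [← assocEnd_mul, mul_left_comm, hfg, assocEnd_mul, assocEnd_X_pow_sub_one,
        LinearMap.zero_apply, map_zero]
    rw [map_add, hker, zero_add]
    nth_rewrite 2 [← hsplit a]
    rw [map_add, hker, zero_add]

end Linearized

lemma two_rpow_mul_lt_min {q n m : ℝ} {k : ℕ} (hm : m = k) (hq3 : 3 ≤ q) (hn5 : 5 ≤ n)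
    (hmq : m + 1 ≤ q) (hmn : 2 * m ≤ n) :
    (2 : ℝ) ^ (1 - m / 2) * (m ^ 2 + 1) < min (q ^ 2) (n ^ 2 / 4) := by
  have hmin : ∀ x : ℝ, x < 25 / 4 ∨ x < m ^ 2 → x < min (q ^ 2) (n ^ 2 / 4) := by
    have hm0 : 0 ≤ m := hm ▸ Nat.cast_nonneg k
    rintro x (h | h) <;> refine lt_min ?_ ?_ <;> nlinarith
  have hle : ∀ c : ℝ, ((4 : ℝ) * 2⁻¹ ^ k ≤ c ^ 2) → 0 ≤ c → (2 : ℝ) ^ (1 - m / 2) ≤ c := by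
    intro c hc hc0
    refine (sq_le_sq₀ (by positivity) hc0).1 ?_
    refine le_trans (le_of_eq ?_) hc
    rw [← Real.rpow_mul_natCast two_pos.le, hm, show (1 - (k : ℝ) / 2) * (2 : ℕ) = 2 - k by
      push_cast; ring, Real.rpow_sub two_pos, Real.rpow_natCast, inv_pow, div_eq_mul_inv]
    norm_num
  apply hmin
  have hc0 : (0 : ℝ) ≤ 2 ^ (1 - m / 2) := by positivity
  rcases Nat.lt_or_ge k 3 with hk | hk
  · left
    interval_cases k
    · have := hle 2 (by norm_num) (by norm_num)
      subst hm; norm_num at this ⊢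
    · have := hle (3 / 2) (by norm_num) (by norm_num)
      subst hm; norm_num at this ⊢; linarith
    · have := hle 1 (by norm_num) (by norm_num)
      subst hm; norm_num at this ⊢
  · right
    have hm3 : (3 : ℝ) ≤ m := by rw [hm]; exact_mod_cast hk
    have := hle (18 / 25) (by
      have : (2⁻¹ : ℝ) ^ k ≤ 2⁻¹ ^ 3 :=
        pow_le_pow_of_le_one (by norm_num) (by norm_num) hk
      norm_num at this ⊢; linarith) (by norm_num)
    nlinarith [mul_le_mul_of_nonneg_right this (by positivity : 0 ≤ m ^ 2 + 1)]

lemma sieve_inequality {q n m M : ℕ} {W : ℝ} (hW : 1 ≤ W) (hq3 : 3 ≤ q) (hn5 : 5 ≤ n)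
    (hmq : m + 1 ≤ q) (hmn : 2 * m ≤ n) (hM : m + 2 * M + 2 ≤ n)
    (hbound : (2 : ℝ) ^ ((n : ℝ) / 2 - 2) * min ((q : ℝ) ^ 2) ((n : ℝ) ^ 2 / 4) * W
      ≤ (q : ℝ) ^ ((n : ℝ) / 2 - 2)) :
    W * 2 ^ M * (1 - m / q + m * (1 - (q : ℝ)⁻¹)) * ((q : ℝ) ^ 2 * √((q : ℝ) ^ n)) <
      (q : ℝ) ^ n * (1 - m / q : ℝ) := by
  have hq0 : (0 : ℝ) < q := by exact_mod_cast (by omega : 0 < q)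
  set r := (q : ℝ) ^ ((n : ℝ) / 2 - 2) with hr
  have hr0 : 0 < r := Real.rpow_pos_of_pos hq0 _
  have hqn : (q : ℝ) ^ n = (r * q ^ 2) ^ 2 := by
    rw [hr, ← Real.rpow_natCast, ← Real.rpow_natCast (q : ℝ) 2, ← Real.rpow_add hq0,
      ← Real.rpow_natCast _ 2, ← Real.rpow_mul hq0.le]
    congr 1
    push_cast
    ring
  rw [hqn, Real.sqrt_sq (by positivity)]
  have hmq' : (m : ℝ) + 1 ≤ q := by exact_mod_cast hmq
  have hlt := two_rpow_mul_lt_min (q := q) (n := n) (m := m) rfl (by exact_mod_cast hq3)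
    (by exact_mod_cast hn5) hmq' (by exact_mod_cast hmn)
  set μ := min ((q : ℝ) ^ 2) ((n : ℝ) ^ 2 / 4) with hμ
  have h2M : (2 : ℝ) ^ M ≤ 2 ^ ((n : ℝ) / 2 - 2) * 2 ^ (1 - (m : ℝ) / 2) := by
    rw [← Real.rpow_natCast, ← Real.rpow_add two_pos]
    refine Real.rpow_le_rpow_of_exponent_le one_le_two ?_
    have : (m : ℝ) + 2 * M + 2 ≤ n := by exact_mod_cast hM
    linarith
  have hΔ : (q : ℝ) + m * (q - 2) ≤ (q - m) * (m ^ 2 + 1) := by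
    rcases Nat.eq_zero_or_pos m with rfl | hm
    · simp
    · have hm1 : (1 : ℝ) ≤ m := by exact_mod_cast hm
      nlinarith [mul_nonneg (mul_nonneg (by linarith : (0 : ℝ) ≤ m) (sub_nonneg.2 hm1))
        (by linarith : (0 : ℝ) ≤ q - m - 1)]
  have hqm : (0 : ℝ) < q - m := by linarith
  have main : W * 2 ^ M * (q + m * (q - 2)) < r * (q - m) := by
    have hA : (0 : ℝ) < 2 ^ ((n : ℝ) / 2 - 2) := by positivity
    have hc : (0 : ℝ) < 2 ^ (1 - (m : ℝ) / 2) := by positivity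
    have hΔ0 : (0 : ℝ) ≤ q + m * (q - 2) := by
      have : (3 : ℝ) ≤ q := by exact_mod_cast hq3
      have : (0 : ℝ) ≤ m * (q - 2) := mul_nonneg (Nat.cast_nonneg m) (by linarith)
      linarith
    calc W * 2 ^ M * (q + m * (q - 2))
        ≤ W * (2 ^ ((n : ℝ) / 2 - 2) * 2 ^ (1 - (m : ℝ) / 2)) * ((q - m) * (m ^ 2 + 1)) := by
          gcongr
      _ = W * 2 ^ ((n : ℝ) / 2 - 2) * (q - m) * (2 ^ (1 - (m : ℝ) / 2) * (m ^ 2 + 1)) := by ring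
      _ < W * 2 ^ ((n : ℝ) / 2 - 2) * (q - m) * μ := by
          refine mul_lt_mul_of_pos_left hlt ?_
          have : 0 < W := by linarith
          positivity
      _ = (2 ^ ((n : ℝ) / 2 - 2) * μ * W) * (q - m) := by ring
      _ ≤ r * (q - m) := by gcongr
  have e1 : W * 2 ^ M * (1 - m / q + m * (1 - (q : ℝ)⁻¹)) * ((q : ℝ) ^ 2 * (r * q ^ 2)) =
      (W * 2 ^ M * (q + m * (q - 2))) * (r * q ^ 3) := by field_simp; ring
  have e2 : (r * (q : ℝ) ^ 2) ^ 2 * (1 - m / q) = (r * (q - m)) * (r * q ^ 3) := by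
    field_simp
  rw [e1, e2]
  exact mul_lt_mul_of_pos_right main (by positivity)

/-- Let `p` be a prime, `q` a power of `p`, and `n = p^α·n₀ ≥ 5` with `p ∤ n₀` and
`1 < gcd(q - 1, n₀) = s < n₀`.  If `q^{n/2-2} ≥ 2^{n/2-2}·min(q², n²/4)·W(q^n - 1)`,
then `N_f(x^n-1, q^n-1) > 0` for every monic factor `f` of degree 2 of `x^n - 1`. -/
theorem Nf_pos_case_mixed (p : ℕ) (hp : p.Prime) (q e : ℕ) (he : 0 < e) (hq : q = p ^ e)
    (α n₀ n : ℕ) (hn : n = p ^ α * n₀) (hn5 : 5 ≤ n) (hpn : ¬ p ∣ n₀)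
    (s : ℕ) (hs : Nat.gcd (q - 1) n₀ = s) (hs1 : 1 < s) (hsn : s < n₀)
    (F E : Type*) [Field F] [Fintype F] [Field E] [Fintype E] [Algebra F E]
    (hF : Fintype.card F = q) (hE : Fintype.card E = q ^ n)
    (hbound : (2 : ℝ) ^ ((n : ℝ) / 2 - 2) * min ((q : ℝ) ^ 2) ((n : ℝ) ^ 2 / 4)
        * (Wnat (q ^ n - 1) : ℝ) ≤ (q : ℝ) ^ ((n : ℝ) / 2 - 2)) :
    ∀ f : Polynomial F, f.Monic → f.natDegree = 2 → f ∣ (X : Polynomial F) ^ n - 1 →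
      0 < Nf q F E f ((X : Polynomial F) ^ n - 1) (q ^ n - 1) := by
  classical
  subst hF
  rintro f - hf2 ⟨g, hfg⟩
  have hfin : Module.finrank F E = n := by
    rw [Module.card_eq_pow_finrank (K := F)] at hE
    exact Nat.pow_right_injective Fintype.one_lt_card hE
  have hn0 : n ≠ 0 := by omega
  have h0 : (X ^ n - 1 : F[X]) ≠ 0 := X_pow_sub_C_ne_zero (Nat.pos_of_ne_zero hn0) 1
  have hf0 : f ≠ 0 := by rintro rfl; simp [hfg] at h0
  have hg0 : g ≠ 0 := by rintro rfl; simp [hfg] at h0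
  have hgn : g.natDegree + 2 = n := by
    have h := congrArg natDegree hfg
    rw [natDegree_mul hf0 hg0, hf2, ← C_1, natDegree_X_pow_sub_C] at h
    omega
  have hgd : g ∣ X ^ n - 1 := ⟨f, by rw [hfg, mul_comm]⟩
  have hqs : s ≤ Fintype.card F - 1 :=
    hs ▸ Nat.gcd_le_left _ (Nat.sub_pos_of_lt Fintype.one_lt_card)
  have hsn₀ : 2 * s ≤ n₀ := by
    obtain ⟨c, hc⟩ : s ∣ n₀ := hs ▸ Nat.gcd_dvd_right _ _
    have hc2 : 2 ≤ c := by
      by_contra! hlt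
      interval_cases c <;> omega
    nlinarith
  have hn₀n : n₀ ≤ n := hn ▸ Nat.le_mul_of_pos_left _ (pow_pos hp.pos α)
  set t := (monicFactors g).filter (·.natDegree = 1) with ht
  set r := (monicFactors g).filter (¬ ·.natDegree = 1) with hr
  have htr : t.card + 2 * r.card ≤ g.natDegree := card_linear_add_two_mul_card_nonlinear_le hg0
  have hts : t.card ≤ s := hs ▸ card_linear_le hp he hq rfl hn hn0 (by omega) hg0 hgd
  have hunion (P : F[X]) : P ∈ r ∨ P ∈ t ↔ P ∈ monicFactors g := by
    rw [hr, ht, Finset.mem_filter, Finset.mem_filter]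
    tauto
  have hmem : ∀ P ∈ monicFactors g, Irreducible P ∧ P.Monic ∧ P ∣ X ^ Module.finrank F E - 1 :=
    fun P hP => by
      obtain ⟨hi, hm, hd⟩ := (mem_monicFactors hg0).1 hP
      exact ⟨hi, hm, hfin.symm ▸ hd.trans hgd⟩
  have hker : Nat.card (assocEnd F E f).toAddMonoidHom.ker = Fintype.card F ^ 2 := by
    rw [← hf2]
    exact natCard_ker_assocEnd (hfin.symm ▸ Dvd.intro _ hfg.symm)
  have hW0 : Fintype.card F ^ n - 1 ≠ 0 :=
    (Nat.sub_pos_of_lt (Nat.one_lt_pow hn0 Fintype.one_lt_card)).ne'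
  rw [Wnat_eq hW0] at hbound
  have hlt := sieve_inequality (q := Fintype.card F) (m := t.card) (M := r.card)
    (by exact_mod_cast Nat.one_le_two_pow) (by omega) hn5 (by omega) (by omega) (by omega) hbound
  obtain ⟨a, ha, haH⟩ := exists_isFree_and_notMem (assocEnd F E f).toAddMonoidHom (s := r) (t := t)
    (Finset.disjoint_filter_filter_not _ _ _).symm (assocRange E) (k := Fintype.card F)
    (fun u hu => by
      replace hu : u ⊆ monicFactors g := fun P hP => (hunion P).1 (Finset.mem_union.1 (hu hP))
      exact index_iInf_assocRange u (pairwise_isCoprime_of_irreducible_of_monic fun P hP =>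
        ⟨(hmem P (hu hP)).1, (hmem P (hu hP)).2.1⟩) fun P hP => (hmem P (hu hP)).2.2)
    (fun P hP => by
      have h := hmem P (Finset.mem_filter.1 hP).1
      exact one_ne_index_assocRange h.1 h.2.2)
    (fun P hP => by
      obtain ⟨hP, hP1⟩ := Finset.mem_filter.1 hP
      rw [index_assocRange (hmem P hP).2.2, hP1, pow_one])
    (by omega)
    (by
      rw [hker, hE]
      push_cast at hlt ⊢
      exact hlt)
  obtain ⟨b, hb, hba⟩ := exists_isPolyFree_of_notMem (by rw [hfin, hfg]) fun P hP =>
    haH P (Finset.mem_union.2 ((hunion P).2 hP))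
  rw [hfin] at hb
  rw [hE] at ha
  have : Nonempty {α : E // IsPolyFree (Fintype.card F) (X ^ n - 1 : F[X]) α ∧
      IsFree (Fintype.card F ^ n - 1) (Lf (Fintype.card F) f α)} :=
    ⟨b, hb, by rw [← assocEnd_apply, hba]; exact ha⟩
  exact Nat.card_pos

end
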